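/- Let λ ≠ 0, assume K_{h,Q,x}(−λ) is finite, and assume h(x,·) is integrable with respect to the (h,Q,λ)-Gibbs probability measure P^{(h,Q,λ)}_{Y|X=x}. Then for all probability measures P₁ and P₂ on ℝ^m, each absolutely continuous with respect to Q, such that h(x,·) is integrable with respect to P₁ and P₂ and D(P₁‖Q) and D(P₂‖Q) are finite, the variation satisfies G_h(x, P₁, P₂) = (1/λ) ( D(P₁‖P^{(h,Q,λ)}_{Y|X=x}) − D(P₂‖P^{(h,Q,λ)}_{Y|X=x}) + D(P₂‖Q) − D(P₁‖Q) ). -/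

import Mathlib

open MeasureTheory Real ProbabilityTheory

/-- Real-valued relative entropy (KL divergence) `D(μ‖ν) = ∫ log (dμ/dν) dμ`. -/
noncomputable def klDivR {α : Type*} [MeasurableSpace α] (μ ν : Measure α) : ℝ :=
  ∫ y, Real.log ((μ.rnDeriv ν y).toReal) ∂μ

/-- `cgfK h Q x t = K_{h,Q,x}(t) = log ∫ exp (t * h x y) dQ(y)`. -/
noncomputable def cgfK {n m : ℕ} (h : (Fin n → ℝ) → (Fin m → ℝ) → ℝ)
    (Q : Measure (Fin m → ℝ)) (x : Fin n → ℝ) (t : ℝ) : ℝ :=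
  Real.log (∫ y, Real.exp (t * h x y) ∂Q)

/-- The `(h,Q,λ)`-Gibbs probability measure `P^{(h,Q,λ)}_{Y|X=x}`, which has density
`exp (-λ * h(x,y) - K_{h,Q,x}(-λ))` with respect to `Q`. -/
noncomputable def gibbs {n m : ℕ} (h : (Fin n → ℝ) → (Fin m → ℝ) → ℝ)
    (Q : Measure (Fin m → ℝ)) (lam : ℝ) (x : Fin n → ℝ) : Measure (Fin m → ℝ) :=
  Q.withDensity fun y => ENNReal.ofReal (Real.exp (-lam * h x y - cgfK h Q x (-lam)))

/-- A Gibbs measure is the exponential tilting of its reference measure. -/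
lemma gibbs_eq_tilted {n m : ℕ} (h : (Fin n → ℝ) → (Fin m → ℝ) → ℝ)
    (Q : Measure (Fin m → ℝ)) (x : Fin n → ℝ) (lam : ℝ)
    (hKpos : 0 < ∫ y, Real.exp (-lam * h x y) ∂Q) :
    gibbs h Q lam x = Q.tilted fun y => -lam * h x y := by
  simp only [gibbs, Measure.tilted, cgfK, Real.exp_sub, Real.exp_log hKpos]

/-- Changing the reference measure of the relative entropy from `Q` to the Gibbs measure. -/
lemma klDivR_gibbs {n m : ℕ} (h : (Fin n → ℝ) → (Fin m → ℝ) → ℝ)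
    (Q : Measure (Fin m → ℝ)) [SigmaFinite Q] (x : Fin n → ℝ) (lam : ℝ)
    (hKint : Integrable (fun y => Real.exp (-lam * h x y)) Q)
    (hKpos : 0 < ∫ y, Real.exp (-lam * h x y) ∂Q)
    (P : Measure (Fin m → ℝ)) [IsProbabilityMeasure P] (hPQ : P ≪ Q)
    (hP : Integrable (h x) P)
    (hPlog : Integrable (fun y => Real.log ((P.rnDeriv Q y).toReal)) P) :
    klDivR P (gibbs h Q lam x)
      = klDivR P Q + lam * ∫ y, h x y ∂P + cgfK h Q x (-lam) := by
  have key := integral_llr_tilted_right hPQ (hP.const_mul (-lam)) hKint hPlog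
  rw [integral_const_mul] at key
  simp only [llr_def] at key
  rw [gibbs_eq_tilted h Q x lam hKpos, klDivR, klDivR, cgfK, key]
  ring

theorem stmt7 {n m : ℕ} (h : (Fin n → ℝ) → (Fin m → ℝ) → ℝ)
    (hMeas : Measurable (Function.uncurry h))
    (Q : Measure (Fin m → ℝ)) [SigmaFinite Q]
    (x : (Fin n → ℝ)) (lam : ℝ) (hlam : lam ≠ 0)
    (hKint : Integrable (fun y => Real.exp (-lam * h x y)) Q)
    (hKpos : 0 < ∫ y, Real.exp (-lam * h x y) ∂Q)
    (hGint : Integrable (h x) (gibbs h Q lam x)) :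
    ∀ P₁ P₂ : Measure (Fin m → ℝ), IsProbabilityMeasure P₁ → IsProbabilityMeasure P₂ →
      P₁ ≪ Q → P₂ ≪ Q →
      Integrable (h x) P₁ → Integrable (h x) P₂ →
      Integrable (fun y => Real.log ((P₁.rnDeriv Q y).toReal)) P₁ →
      Integrable (fun y => Real.log ((P₂.rnDeriv Q y).toReal)) P₂ →
      (∫ y, h x y ∂P₁) - (∫ y, h x y ∂P₂)
        = (1 / lam) * (klDivR P₁ (gibbs h Q lam x) - klDivR P₂ (gibbs h Q lam x)
            + klDivR P₂ Q - klDivR P₁ Q) := by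
  intro P₁ P₂ _ _ hP₁Q hP₂Q hP₁ hP₂ hP₁log hP₂log
  rw [klDivR_gibbs h Q x lam hKint hKpos P₁ hP₁Q hP₁ hP₁log,
    klDivR_gibbs h Q x lam hKint hKpos P₂ hP₂Q hP₂ hP₂log]
  field_simp
  ring
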